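/- arXiv:2303.02658 — 7 statements merged into one kernel-verified Lean document; each statement's English description precedes it below -/
import Mathlib

section
/- For every positive integer d and any two domains X and X* with |X| ≥ 3d and |X*| ≥ 3d, there exist hypothesis classes H_d ⊆ {0,1}^X and Φ_d ⊆ {0,1}^{X*} such that VCdim(H_d) = d, VCdim(Φ_d) = d, and the composite loss class F_{(H_d,Φ_d)} has VC dimension at least 3d. (In particular, VCdim(F_{(H,Φ)}) is in general strictly larger than VCdim(H) + VCdim(Φ).) -/
/-- A class `G` of `Bool`-valued functions shatters a finite set `C` if every
`{0,1}`-labeling of `C` is realized by some `g ∈ G`. -/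
def Shatters {Z : Type*} (G : Set (Z → Bool)) (C : Finset Z) : Prop :=
  ∀ f : Z → Bool, ∃ g ∈ G, ∀ z ∈ C, g z = f z

/-- The VC dimension of a class of `Bool`-valued functions: the supremum of the
cardinalities of shattered finite sets. -/
noncomputable def vcDim {Z : Type*} (G : Set (Z → Bool)) : ℕ∞ :=
  ⨆ C ∈ {C : Finset Z | Shatters G C}, (C.card : ℕ∞)

/-- The composite privileged-ERM loss `f_{(h,φ)}((x,x*),y) = max(1[h(x)≠y], 1[φ(x*)=1])`. -/
def compLoss {X Xs : Type*} (h : X → Bool) (φ : Xs → Bool) : (X × Xs) × Bool → Bool :=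
  fun p => (h p.1.1 != p.2) || φ p.1.2

/-- The composite loss class `F_{(H,Φ)}`. -/
def FClass {X Xs : Type*} (H : Set (X → Bool)) (Φ : Set (Xs → Bool)) :
    Set ((X × Xs) × Bool → Bool) :=
  { f | ∃ h ∈ H, ∃ φ ∈ Φ, f = compLoss h φ }

/-- A shattered set bounds the VC dimension from below. -/
theorem Shatters.card_le_vcDim {Z : Type*} {G : Set (Z → Bool)} {C : Finset Z}
    (hC : Shatters G C) : (C.card : ℕ∞) ≤ vcDim G :=
  le_iSup₂_of_le (f := fun (C : Finset Z) (_ : C ∈ {C : Finset Z | Shatters G C}) =>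
    (C.card : ℕ∞)) C hC le_rfl

/-- The functions on `Z` vanishing off the range of `e` whose restriction to each block
`{e (i, j) | i}` belongs to `L`. -/
def blockClass {ι κ Z : Type*} (e : ι × κ ↪ Z) (L : Set (ι → Bool)) : Set (Z → Bool) :=
  {g | ∃ l : κ → ι → Bool, (∀ j, l j ∈ L) ∧
    g = Function.extend e (fun p => l p.2 p.1) (fun _ => false)}

/-- A set shattered by a block class meets each block at most once when the local class
shatters no pair. -/
theorem Shatters.card_le_of_blockClass {ι κ Z : Type*} [Fintype ι] [Fintype κ]
    {e : ι × κ ↪ Z} {L : Set (ι → Bool)}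
    (hL : ∀ i i', i ≠ i' → ∃ a b, ∀ l ∈ L, ¬(l i = a ∧ l i' = b))
    {C : Finset Z} (hC : Shatters (blockClass e L) C) : C.card ≤ Fintype.card κ := by
  classical
  have hsub : C ⊆ Finset.univ.map e := by
    obtain ⟨g, ⟨l, -, rfl⟩, hg⟩ := hC fun _ => true
    intro z hz
    by_contra hne
    have hz' := hg z hz
    rw [Function.extend_apply' _ _ _ (by simpa using hne)] at hz'
    exact Bool.false_ne_true hz'
  obtain ⟨D, -, rfl⟩ := Finset.subset_map_iff.1 hsub
  rw [Finset.card_map]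
  by_contra! hlt
  obtain ⟨p, hp, q, hq, hpq, hblock⟩ :=
    Finset.exists_ne_map_eq_of_card_lt_of_maps_to (s := D) (t := Finset.univ)
      (by simpa using hlt) (f := Prod.snd) (fun _ _ => by simp)
  have hfst : p.1 ≠ q.1 := fun h => hpq (Prod.ext h hblock)
  obtain ⟨a, b, hab⟩ := hL _ _ hfst
  obtain ⟨g, ⟨l, hl, rfl⟩, hg⟩ := hC fun z => if z = e p then a else b
  have hgp := hg (e p) (Finset.mem_map_of_mem _ hp)
  have hgq := hg (e q) (Finset.mem_map_of_mem _ hq)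
  rw [e.injective.extend_apply, if_pos rfl] at hgp
  rw [e.injective.extend_apply, if_neg fun h => hpq (e.injective h).symm, ← hblock] at hgq
  exact hab _ (hl _) ⟨hgp, hgq⟩

/-- If the local class shatters a point but no pair, the VC dimension of the block class is the
number of blocks. -/
theorem vcDim_blockClass {ι κ Z : Type*} [Fintype ι] [Fintype κ]
    (e : ι × κ ↪ Z) {L : Set (ι → Bool)} (i : ι) (hi : ∀ b, ∃ l ∈ L, l i = b)
    (hL : ∀ i i', i ≠ i' → ∃ a b, ∀ l ∈ L, ¬(l i = a ∧ l i' = b)) :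
    vcDim (blockClass e L) = Fintype.card κ := by
  refine le_antisymm (iSup₂_le fun C hC => by exact_mod_cast hC.card_le_of_blockClass hL) ?_
  let c : κ ↪ Z := (Function.Embedding.sectR i κ).trans e
  have hc : Shatters (blockClass e L) (Finset.univ.map c) := by
    intro f
    choose l hl hli using hi
    refine ⟨_, ⟨fun j => l (f (e (i, j))), fun _ => hl _, rfl⟩, fun z hz => ?_⟩
    obtain ⟨j, -, rfl⟩ := Finset.mem_map.1 hz
    exact (e.injective.extend_apply _ _ (i, j)).trans (hli _)
  simpa using hc.card_le_vcDim

/-- If every pattern on a block is the disjunction of patterns from `L` and `M`, the composite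
loss class of the two block classes shatters a set containing one point for each index. -/
theorem card_le_vcDim_FClass_blockClass {ι κ X Xs : Type*} [Fintype ι] [Fintype κ]
    (e : ι × κ ↪ X) (e' : ι × κ ↪ Xs) {L M : Set (ι → Bool)}
    (hLM : ∀ s : ι → Bool, ∃ l ∈ L, ∃ m ∈ M, ∀ i, (l i || m i) = s i) :
    (Fintype.card (ι × κ) : ℕ∞) ≤ vcDim (FClass (blockClass e L) (blockClass e' M)) := by
  let c : ι × κ ↪ (X × Xs) × Bool :=
    ⟨fun p => ((e p, e' p), false), fun p q h => e.injective (by simp_all)⟩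
  have hc : Shatters (FClass (blockClass e L) (blockClass e' M)) (Finset.univ.map c) := by
    intro f
    choose l hl m hm hlm using hLM
    let s : κ → ι → Bool := fun j i => f (c (i, j))
    refine ⟨_, ⟨_, ⟨fun j => l (s j), fun _ => hl _, rfl⟩,
      _, ⟨fun j => m (s j), fun _ => hm _, rfl⟩, rfl⟩, fun z hz => ?_⟩
    obtain ⟨p, -, rfl⟩ := Finset.mem_map.1 hz
    change (Function.extend e _ _ (e p) != false || Function.extend e' _ _ (e' p)) = s p.2 p.1
    rw [e.injective.extend_apply, e'.injective.extend_apply, Bool.bne_false]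
    exact hlm (s p.2) p.1
  simpa using hc.card_le_vcDim

/-- For every positive `d` and domains of size at least `3d`, there exist classes
`H`, `Φ` of VC dimension `d` whose composite loss class has VC dimension at least `3d`. -/
theorem composite_loss_class_vc_lower_bound
    (d : ℕ) (hd : 0 < d) (X Xs : Type*)
    (hX : Nonempty (Fin (3 * d) ↪ X)) (hXs : Nonempty (Fin (3 * d) ↪ Xs)) :
    ∃ (H : Set (X → Bool)) (Φ : Set (Xs → Bool)),
      vcDim H = (d : ℕ∞) ∧ vcDim Φ = (d : ℕ∞) ∧
      (3 * d : ℕ) ≤ vcDim (FClass H Φ) := by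
  obtain ⟨e⟩ := hX
  obtain ⟨e'⟩ := hXs
  let r : Fin 3 × Fin d ↪ Fin (3 * d) := finProdFinEquiv.toEmbedding
  let L : Set (Fin 3 → Bool) := {l | ∀ i i', i ≠ i' → ¬(l i = true ∧ l i' = true)}
  let M : Set (Fin 3 → Bool) := {l | l 0 = l 1 ∧ ¬(l 0 = true ∧ l 2 = true)}
  refine ⟨blockClass (r.trans e) L, blockClass (r.trans e') M, ?_, ?_, ?_⟩
  · simpa using vcDim_blockClass (r.trans e) (L := L) 0
      (by simp only [L, Set.mem_ofPred_eq]; decide)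
      fun i i' h => ⟨true, true, fun l hl => hl i i' h⟩
  · simpa using vcDim_blockClass (r.trans e') (L := M) 0
      (by simp only [M, Set.mem_ofPred_eq]; decide)
      (by simp only [M, Set.mem_ofPred_eq]; decide)
  · simpa using card_le_vcDim_FClass_blockClass (r.trans e) (r.trans e') (L := L) (M := M)
      (by simp only [L, M, Set.mem_ofPred_eq]; decide)
end

section
/- For any natural numbers d and d*, there exist a domain X and hypothesis classes H, J ⊆ {0,1}^X such that VCdim(H) = d, VCdim(J) = d*, and VCdim(H ∪ J) = d + d* + 1. Concretely, one may take X of cardinality d + d* + 1, H the set of all functions mapping at most d points of X to 1, and J the set of all functions mapping at most d* points of X to 0; then H ∪ J is the set of all functions from X to {0,1}. -/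
/-- A class that shatters a set of size `k` and none of larger size has VC dimension `k`. -/
theorem vcDim_eq_of_shatters {Z : Type*} {G : Set (Z → Bool)} {C : Finset Z}
    (hC : Shatters G C) (hmax : ∀ D, Shatters G D → D.card ≤ C.card) :
    vcDim G = (C.card : ℕ∞) :=
  le_antisymm (iSup₂_le fun D hD => Nat.cast_le.mpr (hmax D hD))
    (le_iSup₂_of_le C hC le_rfl)

/-- The class of all functions on a finite domain has full VC dimension. -/
theorem vcDim_univ {Z : Type*} [Fintype Z] :
    vcDim (Set.univ : Set (Z → Bool)) = (Fintype.card Z : ℕ∞) :=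
  vcDim_eq_of_shatters (C := Finset.univ) (fun f => ⟨f, Set.mem_univ f, fun _ _ => rfl⟩)
    fun D _ => D.card_le_univ

/-- The class of functions taking the value `b` at most `k` times has VC dimension `k`,
as long as the domain has at least `k` points. -/
theorem vcDim_card_fiber_le {Z : Type*} [Fintype Z] (b : Bool) {k : ℕ}
    (hk : k ≤ Fintype.card Z) :
    vcDim {f : Z → Bool | (Finset.univ.filter (fun x => f x = b)).card ≤ k} = (k : ℕ∞) := by
  classical
  obtain ⟨C, -, rfl⟩ := Finset.exists_subset_card_eq (s := (Finset.univ : Finset Z)) hk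
  refine vcDim_eq_of_shatters (fun f => ?_) fun D hD => ?_
  · refine ⟨fun z => if z ∈ C then f z else !b, Finset.card_le_card fun z hz => ?_,
      fun z hz => if_pos hz⟩
    by_contra hzC
    simp [hzC] at hz
  · obtain ⟨g, hg, hgD⟩ := hD fun _ => b
    exact (Finset.card_le_card fun z hz => by simp [hgD z hz]).trans hg

/-- On a domain of `m + n + 1` points, every function takes the value `1` at most `m` times
or the value `0` at most `n` times. -/
theorem card_true_le_union_card_false_le (m n : ℕ) :
    ({f : Fin (m + n + 1) → Bool | (Finset.univ.filter (fun x => f x = true)).card ≤ m} ∪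
      {f : Fin (m + n + 1) → Bool | (Finset.univ.filter (fun x => f x = false)).card ≤ n}) =
      Set.univ := by
  refine Set.eq_univ_of_forall fun f => ?_
  have h := Finset.card_filter_add_card_filter_not (s := Finset.univ) (fun x => f x = true)
  simp only [Bool.not_eq_true, Finset.card_univ, Fintype.card_fin] at h
  simp only [Set.mem_union, Set.mem_ofPred_eq]
  omega

/-- Tightness of the union bound: over the domain `X = Fin (d + d* + 1)`, taking
`H` to be all functions mapping at most `d` points to `1` and `J` all functions
mapping at most `d*` points to `0`, we have `VCdim(H) = d`, `VCdim(J) = d*`,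
`H ∪ J` is the set of all functions, and `VCdim(H ∪ J) = d + d* + 1`. -/
theorem vcDim_union_tight (d dstar : ℕ) :
    vcDim {f : Fin (d + dstar + 1) → Bool |
        (Finset.univ.filter (fun x => f x = true)).card ≤ d} = (d : ℕ∞) ∧
    vcDim {f : Fin (d + dstar + 1) → Bool |
        (Finset.univ.filter (fun x => f x = false)).card ≤ dstar} = (dstar : ℕ∞) ∧
    ({f : Fin (d + dstar + 1) → Bool |
        (Finset.univ.filter (fun x => f x = true)).card ≤ d} ∪
      {f : Fin (d + dstar + 1) → Bool |
        (Finset.univ.filter (fun x => f x = false)).card ≤ dstar}) = Set.univ ∧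
    vcDim ({f : Fin (d + dstar + 1) → Bool |
        (Finset.univ.filter (fun x => f x = true)).card ≤ d} ∪
      {f : Fin (d + dstar + 1) → Bool |
        (Finset.univ.filter (fun x => f x = false)).card ≤ dstar})
      = ((d + dstar + 1 : ℕ) : ℕ∞) := by
  refine ⟨vcDim_card_fiber_le true (by simp; omega), vcDim_card_fiber_le false (by simp; omega),
    card_true_le_union_card_false_le d dstar, ?_⟩
  rw [card_true_le_union_card_false_le, vcDim_univ, Fintype.card_fin]
end

section
/- Let H ⊆ {0,1}^X and Φ ⊆ {0,1}^{X*} be hypothesis classes with VCdim(H) = d and VCdim(Φ) = d*. Then the composite loss class F_{(H,Φ)} satisfies VCdim(F_{(H,Φ)}) ≤ 4·log₂(4e)·(d + d* + 1). -/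
/-- The traces on `C` of the class `G` pulled back along `p`. -/
noncomputable def pullbackTraces {W Z : Type*} (p : W → Z) (G : Set (Z → Bool)) (C : Finset W) :
    Finset (Finset C) :=
  open Classical in Finset.univ.filter fun s => ∃ g ∈ G, ∀ w : C, w ∈ s ↔ g (p w) = true

lemma Shatters.card_le_of_vcDim_eq {Z : Type*} {G : Set (Z → Bool)} {d : ℕ}
    (hG : vcDim G = (d : ℕ∞)) {T : Finset Z} (hT : Shatters G T) : T.card ≤ d := by
  have h : (T.card : ℕ∞) ≤ vcDim G :=
    le_iSup₂ (f := fun (C : Finset Z) (_ : C ∈ {C : Finset Z | Shatters G C}) => (C.card : ℕ∞)) T hT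
  rw [hG] at h
  exact_mod_cast h

lemma card_le_of_pullbackTraces_shatters {W Z : Type*} [DecidableEq W] (p : W → Z)
    {G : Set (Z → Bool)} {d : ℕ} (hG : vcDim G = (d : ℕ∞)) (C : Finset W) {T : Finset C}
    (hT : (pullbackTraces p G C).Shatters T) : T.card ≤ d := by
  classical
  have hreal : ∀ u ⊆ T, ∃ g ∈ G, ∀ w ∈ T, w ∈ u ↔ g (p w) = true := by
    intro u hu
    obtain ⟨v, hv, rfl⟩ := hT hu
    obtain ⟨g, hg, hgv⟩ := (Finset.mem_filter.1 hv).2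
    exact ⟨g, hg, fun w hw => by simp [hw, hgv w]⟩
  have hinj : Set.InjOn (fun w : C => p w) T := by
    intro a ha b hb hab
    obtain ⟨g, -, hg⟩ := hreal {a} (by simpa using ha)
    have h1 : g (p a) = true := (hg a ha).1 (by simp)
    have h2 := (hg b hb).2 (by rw [← h1]; exact congrArg g hab.symm)
    exact (Finset.mem_singleton.1 h2).symm
  rw [← Finset.card_image_of_injOn hinj]
  refine Shatters.card_le_of_vcDim_eq hG fun f => ?_
  obtain ⟨g, hg, hgf⟩ := hreal (T.filter fun w => f (p w) = true) (Finset.filter_subset _ _)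
  refine ⟨g, hg, fun z hz => ?_⟩
  obtain ⟨w, hw, rfl⟩ := Finset.mem_image.1 hz
  have h := hgf w hw
  simp only [Finset.mem_filter, hw, true_and] at h
  exact (Bool.eq_iff_iff.2 h).symm

lemma sum_choose_le_pow (m d : ℕ) :
    (∑ k ∈ Finset.Iic d, (m.choose k : ℝ)) ≤ (5 / 4) ^ m * 4 ^ d := by
  have hle : ∑ k ∈ Finset.Iic d, (m.choose k : ℝ) * (1 / 4) ^ k ≤ (5 / 4) ^ m := by
    have hbin : ((5 : ℝ) / 4) ^ m =
        ∑ k ∈ Finset.range (m + 1), (m.choose k : ℝ) * (1 / 4) ^ k := by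
      rw [show (5 : ℝ) / 4 = 1 / 4 + 1 by norm_num, add_pow]
      exact Finset.sum_congr rfl fun k _ => by ring
    rw [hbin, ← Finset.sum_filter_ne_zero]
    refine Finset.sum_le_sum_of_subset_of_nonneg (fun k hk => Finset.mem_range.2 ?_)
      fun k _ _ => by positivity
    replace hk := (Finset.mem_filter.1 hk).2
    by_contra hkm
    exact hk (by simp [Nat.choose_eq_zero_of_lt (show m < k by lia)])
  calc (∑ k ∈ Finset.Iic d, (m.choose k : ℝ))
      ≤ ∑ k ∈ Finset.Iic d, (m.choose k : ℝ) * (1 / 4) ^ k * 4 ^ d := by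
        refine Finset.sum_le_sum fun k hk => ?_
        have h4 : (4 : ℝ) ^ k ≤ 4 ^ d := pow_le_pow_right₀ (by norm_num) (Finset.mem_Iic.1 hk)
        have h1 : (1 : ℝ) ≤ (1 / 4) ^ k * 4 ^ d := by
          calc (1 : ℝ) = (1 / 4) ^ k * 4 ^ k := by rw [← mul_pow]; norm_num
            _ ≤ _ := by gcongr
        rw [mul_assoc]
        exact le_mul_of_one_le_right (by positivity) h1
    _ = (∑ k ∈ Finset.Iic d, (m.choose k : ℝ) * (1 / 4) ^ k) * 4 ^ d := by rw [Finset.sum_mul]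
    _ ≤ _ := by gcongr

lemma card_pullbackTraces_le {W Z : Type*} (p : W → Z) {G : Set (Z → Bool)} {d : ℕ}
    (hG : vcDim G = (d : ℕ∞)) (C : Finset W) :
    ((pullbackTraces p G C).card : ℝ) ≤ (5 / 4) ^ C.card * 4 ^ d := by
  classical
  have hvc : (pullbackTraces p G C).vcDim ≤ d := Finset.sup_le fun T hT =>
    card_le_of_pullbackTraces_shatters p hG C (Finset.mem_shatterer.1 hT)
  have h : (pullbackTraces p G C).card ≤ ∑ k ∈ Finset.Iic d, C.card.choose k := by
    refine (Finset.card_le_card_shatterer _).trans (Finset.card_shatterer_le_sum_vcDim.trans ?_)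
    rw [Fintype.card_coe]
    exact Finset.sum_le_sum_of_subset (Finset.Iic_subset_Iic.2 hvc)
  refine le_trans ?_ (sum_choose_le_pow C.card d)
  exact_mod_cast h

lemma two_pow_card_le_of_shatters_FClass {X Xs : Type*} {H : Set (X → Bool)}
    {Φ : Set (Xs → Bool)} {C : Finset ((X × Xs) × Bool)} (hC : Shatters (FClass H Φ) C) :
    2 ^ C.card ≤ (pullbackTraces (fun w : (X × Xs) × Bool => w.1.1) H C).card *
      (pullbackTraces (fun w : (X × Xs) × Bool => w.1.2) Φ C).card := by
  classical
  rw [← Finset.card_product, ← Fintype.card_coe C, ← Fintype.card_finset, ← Finset.card_univ]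
  refine Finset.card_le_card_of_surjOn
    (fun q => Finset.univ.filter fun w : C =>
      ((decide (w ∈ q.1) != w.1.2) || decide (w ∈ q.2)) = true)
    fun s _ => ?_
  obtain ⟨f, ⟨h, hh, φ, hφ, rfl⟩, hf⟩ := hC fun z => decide (∃ hz : z ∈ C, (⟨z, hz⟩ : C) ∈ s)
  refine ⟨(Finset.univ.filter fun w : C => h w.1.1.1 = true,
    Finset.univ.filter fun w : C => φ w.1.1.2 = true), ?_, ?_⟩
  · simp only [Finset.coe_product, Set.mem_prod, Finset.mem_coe, pullbackTraces,
      Finset.mem_filter, Finset.mem_univ, true_and]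
    exact ⟨⟨h, hh, fun w => Iff.rfl⟩, ⟨φ, hφ, fun w => Iff.rfl⟩⟩
  · ext w
    have hw := hf w.1 w.2
    simp only [compLoss] at hw
    simp only [Finset.mem_filter, Finset.mem_univ, true_and, Bool.decide_eq_true, hw,
      decide_eq_true_eq, Subtype.coe_eta, Finset.coe_mem, exists_true_left]

lemma le_six_mul_of_two_pow_le {m D : ℕ} (h : (2 : ℝ) ^ m ≤ (25 / 16) ^ m * 4 ^ D) :
    m ≤ 6 * D := by
  have h1 : ((32 : ℝ) / 25) ^ m ≤ 4 ^ D := by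
    rw [show (32 : ℝ) / 25 = 2 / (25 / 16) by norm_num, div_pow, div_le_iff₀ (by positivity),
      mul_comm]
    exact h
  have h2 : (4 : ℝ) ^ m ≤ 4 ^ (6 * D) := by
    calc (4 : ℝ) ^ m ≤ ((32 / 25) ^ 6) ^ m := by gcongr; norm_num
      _ = ((32 / 25) ^ m) ^ 6 := by rw [← pow_mul, ← pow_mul, mul_comm]
      _ ≤ (4 ^ D) ^ 6 := by gcongr
      _ = 4 ^ (6 * D) := by rw [← pow_mul, mul_comm]
  exact (pow_le_pow_iff_right₀ (by norm_num)).1 h2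

/-- If `VCdim(H) = d` and `VCdim(Φ) = d*`, then the composite loss class satisfies
`VCdim(F_{(H,Φ)}) ≤ 4·log₂(4e)·(d + d* + 1)`: every finite set shattered by
`F_{(H,Φ)}` has cardinality at most this bound. -/
theorem composite_loss_class_vc_upper_bound
    {X Xs : Type*} (H : Set (X → Bool)) (Φ : Set (Xs → Bool)) (d dstar : ℕ)
    (hH : vcDim H = (d : ℕ∞)) (hΦ : vcDim Φ = (dstar : ℕ∞)) :
    ∀ C : Finset ((X × Xs) × Bool), Shatters (FClass H Φ) C →
      (C.card : ℝ) ≤ 4 * Real.logb 2 (4 * Real.exp 1) * ((d : ℝ) + (dstar : ℝ) + 1) := by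
  intro C hC
  have hcard : C.card ≤ 6 * (d + dstar) := by
    apply le_six_mul_of_two_pow_le
    calc (2 : ℝ) ^ C.card
        ≤ (pullbackTraces (fun w : (X × Xs) × Bool => w.1.1) H C).card *
          (pullbackTraces (fun w : (X × Xs) × Bool => w.1.2) Φ C).card := by
          exact_mod_cast two_pow_card_le_of_shatters_FClass hC
      _ ≤ ((5 / 4) ^ C.card * 4 ^ d) * ((5 / 4) ^ C.card * 4 ^ dstar) := by
          gcongr
          · exact card_pullbackTraces_le _ hH C
          · exact card_pullbackTraces_le _ hΦ C
      _ = (25 / 16) ^ C.card * 4 ^ (d + dstar) := by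
          rw [show (25 : ℝ) / 16 = 5 / 4 * (5 / 4) by norm_num, mul_pow, pow_add]
          ring
  have hlog : 2 ≤ Real.logb 2 (4 * Real.exp 1) := by
    rw [Real.le_logb_iff_rpow_le (by norm_num) (by positivity)]
    have := Real.one_le_exp (zero_le_one' ℝ)
    norm_num
  have hcard' : (C.card : ℝ) ≤ 6 * ((d : ℝ) + dstar) := by exact_mod_cast hcard
  have hd : (0 : ℝ) ≤ (d : ℝ) + dstar := by positivity
  nlinarith
end

section
/- Let (X, R) be a set system, where R is a collection of subsets of X, and let k ≥ 2 be an integer. Define the k-fold union R^{k∪} := { R₁ ∪ ⋯ ∪ R_k : R₁, …, R_k ∈ R }. Then the VC dimension of R^{k∪} (as a set system) satisfies VCdim(R^{k∪}) ≤ VCdim(R) · 2k · log₂(2ek). -/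
/-- A set system `R` shatters a finite set `C` if every subset of `C` can be
obtained as the intersection of `C` with a member of `R`. -/
def ShattersSet {X : Type*} (R : Set (Set X)) (C : Finset X) : Prop :=
  ∀ D : Finset X, D ⊆ C → ∃ r ∈ R, (C : Set X) ∩ r = (D : Set X)

/-- The VC dimension of a set system: the supremum of the cardinalities of
shattered finite sets. -/
noncomputable def vcDimSet {X : Type*} (R : Set (Set X)) : ℕ∞ :=
  ⨆ C ∈ {C : Finset X | ShattersSet R C}, (C.card : ℕ∞)

/-- The `k`-fold union `R^{k∪}` of a set system `R`. -/
def kFoldUnion {X : Type*} (R : Set (Set X)) (k : ℕ) : Set (Set X) :=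
  {s | ∃ f : Fin k → Set X, (∀ i, f i ∈ R) ∧ s = ⋃ i, f i}

/-- The sets cut out of `C` by the members of `R`. -/
noncomputable def traceFamily {X : Type*} (R : Set (Set X)) (C : Finset X) :
    Finset (Finset X) :=
  open Classical in C.powerset.filter fun D ↦ ∃ r ∈ R, (C : Set X) ∩ r = (D : Set X)

theorem mem_traceFamily {X : Type*} {R : Set (Set X)} {C D : Finset X} :
    D ∈ traceFamily R C ↔ ∃ r ∈ R, (C : Set X) ∩ r = (D : Set X) := by
  classical
  simp only [traceFamily, Finset.mem_filter, Finset.mem_powerset, and_iff_right_iff_imp]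
  rintro ⟨r, -, h⟩
  rw [← Finset.coe_subset, ← h]
  exact Set.inter_subset_left

theorem subset_of_mem_traceFamily {X : Type*} {R : Set (Set X)} {C D : Finset X}
    (h : D ∈ traceFamily R C) : D ⊆ C := by
  classical
  exact Finset.mem_powerset.1 (Finset.mem_filter.1 h).1

theorem ShattersSet.card_le {X : Type*} {R : Set (Set X)} {C : Finset X} {d : ℕ}
    (hd : vcDimSet R = (d : ℕ∞)) (h : ShattersSet R C) : C.card ≤ d := by
  have : (C.card : ℕ∞) ≤ vcDimSet R :=
    le_iSup₂ (f := fun (C : Finset X) (_ : C ∈ {C : Finset X | ShattersSet R C}) ↦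
      (C.card : ℕ∞)) C h
  rw [hd] at this
  exact_mod_cast this

/-- The Sauer–Shelah lemma for the family of traces on a finite set. -/
theorem card_traceFamily_le {X : Type*} {R : Set (Set X)} {d : ℕ}
    (hd : vcDimSet R = (d : ℕ∞)) (C : Finset X) :
    (traceFamily R C).card ≤ ∑ i ∈ Finset.range (d + 1), C.card.choose i := by
  classical
  refine (Finset.card_le_card_shatterer _).trans ?_
  have hsub : (traceFamily R C).shatterer ⊆
      (Finset.range (d + 1)).biUnion fun i ↦ C.powersetCard i := by
    intro S hS
    rw [Finset.mem_shatterer] at hS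
    obtain ⟨E, hE, hSE⟩ := hS.exists_superset
    have hSC : S ⊆ C := hSE.trans (subset_of_mem_traceFamily hE)
    have hsh : ShattersSet R S := by
      intro D hD
      obtain ⟨u, hu, rfl⟩ := hS hD
      obtain ⟨r, hr, hru⟩ := mem_traceFamily.1 hu
      refine ⟨r, hr, ?_⟩
      rw [Finset.coe_inter, ← hru, ← Set.inter_assoc,
        Set.inter_eq_left.2 (Finset.coe_subset.2 hSC)]
    simp only [Finset.mem_biUnion, Finset.mem_range, Finset.mem_powersetCard]
    exact ⟨S.card, Nat.lt_succ_of_le (hsh.card_le hd), hSC, rfl⟩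
  calc _ ≤ _ := Finset.card_le_card hsub
    _ ≤ _ := Finset.card_biUnion_le
    _ = _ := by simp

theorem two_pow_card_le_card_traceFamily_pow {X : Type*} {R : Set (Set X)} {k : ℕ}
    {C : Finset X} (h : ShattersSet (kFoldUnion R k) C) :
    2 ^ C.card ≤ (traceFamily R C).card ^ k := by
  classical
  have hsub : C.powerset ⊆
      (Fintype.piFinset fun _ : Fin k ↦ traceFamily R C).image
        fun g ↦ Finset.univ.biUnion g := by
    intro D hD
    obtain ⟨_, ⟨f, hf, rfl⟩, hD⟩ := h D (Finset.mem_powerset.1 hD)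
    have hcoe (i : Fin k) : ((C.filter (· ∈ f i) : Finset X) : Set X) = (C : Set X) ∩ f i := by
      ext; simp
    rw [Finset.mem_image]
    refine ⟨fun i ↦ C.filter (· ∈ f i), ?_, ?_⟩
    · exact Fintype.mem_piFinset.2 fun i ↦ mem_traceFamily.2 ⟨f i, hf i, (hcoe i).symm⟩
    · apply Finset.coe_injective
      rw [← hD, Set.inter_iUnion]
      simp [hcoe]
  calc 2 ^ C.card = C.powerset.card := (Finset.card_powerset C).symm
    _ ≤ _ := Finset.card_le_card hsub
    _ ≤ _ := Finset.card_image_le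
    _ = _ := by simp

theorem sum_range_choose_le_exp_mul_div_pow {n d : ℕ} (hd : 0 < d) (hdn : d ≤ n) :
    (∑ i ∈ Finset.range (d + 1), (n.choose i : ℝ)) ≤ (Real.exp 1 * (n / d)) ^ d := by
  have hd' : (0 : ℝ) < d := by exact_mod_cast hd
  have hdn' : (d : ℝ) ≤ n := by exact_mod_cast hdn
  have hn' : (0 : ℝ) < n := hd'.trans_le hdn'
  have hx0 : (0 : ℝ) < d / n := by positivity
  have hx1 : (d / n : ℝ) ≤ 1 := (div_le_one hn').2 hdn'
  have key : (∑ i ∈ Finset.range (d + 1), (n.choose i : ℝ)) * (d / n : ℝ) ^ d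
      ≤ Real.exp 1 ^ d := by
    calc (∑ i ∈ Finset.range (d + 1), (n.choose i : ℝ)) * (d / n : ℝ) ^ d
        ≤ ∑ i ∈ Finset.range (d + 1), (d / n : ℝ) ^ i * n.choose i := by
          rw [Finset.sum_mul]
          refine Finset.sum_le_sum fun i hi ↦ ?_
          rw [mul_comm]
          gcongr ?_ * _
          exact pow_le_pow_of_le_one hx0.le hx1 (Nat.lt_succ_iff.1 (Finset.mem_range.1 hi))
      _ ≤ ∑ i ∈ Finset.range (n + 1), (d / n : ℝ) ^ i * n.choose i := by
          refine Finset.sum_le_sum_of_subset_of_nonneg ?_ fun i _ _ ↦ by positivity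
          exact Finset.range_mono (by omega)
      _ = (d / n + 1 : ℝ) ^ n := by simp [add_pow]
      _ ≤ Real.exp (d / n) ^ n := by gcongr; exact Real.add_one_le_exp _
      _ = Real.exp 1 ^ d := by
          rw [← Real.exp_nat_mul, ← Real.exp_nat_mul, mul_div_cancel₀ _ hn'.ne', mul_one]
  calc _ ≤ Real.exp 1 ^ d / (d / n : ℝ) ^ d := (le_div_iff₀ (by positivity)).2 key
    _ = _ := by rw [← div_pow, div_div_eq_mul_div, mul_div_assoc]

theorem logb_two_le_self {y : ℝ} (hy : 0 < y) : Real.logb 2 y ≤ y := by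
  have h1 : (1 / 2 : ℝ) < Real.log 2 := by linarith [Real.log_two_gt_d9]
  rw [Real.logb, div_le_iff₀ (by linarith)]
  have h2 : Real.log (y / 2) ≤ y / 2 - 1 := Real.log_le_sub_one_of_pos (by positivity)
  rw [Real.log_div hy.ne' two_ne_zero] at h2
  nlinarith [Real.log_two_lt_d9]

theorem le_of_le_mul_logb_exp_mul {x k : ℝ} (hx : 0 < x) (hk : 0 < k)
    (h : x ≤ k * Real.logb 2 (Real.exp 1 * x)) :
    x ≤ 2 * k * Real.logb 2 (2 * Real.exp 1 * k) := by
  have hy : 0 < x / (2 * k) := by positivity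
  have hxy : Real.exp 1 * x = (2 * Real.exp 1 * k) * (x / (2 * k)) := by field_simp
  rw [hxy, Real.logb_mul (by positivity) hy.ne'] at h
  have h1 := mul_le_mul_of_nonneg_left (logb_two_le_self hy) hk.le
  have h2 : k * (x / (2 * k)) = x / 2 := by field_simp
  linarith

/-- If `R` has VC dimension `d`, then for `k ≥ 2` the `k`-fold union `R^{k∪}`
has VC dimension at most `d · 2k · log₂(2ek)`: every finite set shattered by
`R^{k∪}` has cardinality at most this bound. -/
theorem vcDim_kFoldUnion_le {X : Type*} (R : Set (Set X)) (k : ℕ) (hk : 2 ≤ k)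
    (d : ℕ) (hd : vcDimSet R = (d : ℕ∞)) :
    ∀ C : Finset X, ShattersSet (kFoldUnion R k) C →
      (C.card : ℝ) ≤ (d : ℝ) * (2 * (k : ℝ)) * Real.logb 2 (2 * Real.exp 1 * (k : ℝ)) := by
  intro C hC
  have hcount : 2 ^ C.card ≤ (∑ i ∈ Finset.range (d + 1), C.card.choose i) ^ k :=
    (two_pow_card_le_card_traceFamily_pow hC).trans
      (Nat.pow_le_pow_left (card_traceFamily_le hd C) k)
  rcases Nat.eq_zero_or_pos d with rfl | hd0
  · have : C.card = 0 := by
      by_contra hne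
      have := Nat.one_lt_two_pow hne
      simp at hcount
      omega
    simp [this]
  have hk' : (2 : ℝ) ≤ k := by exact_mod_cast hk
  have hd' : (0 : ℝ) < d := by exact_mod_cast hd0
  rcases le_total C.card d with hle | hle
  · have hle' : (C.card : ℝ) ≤ d := by exact_mod_cast hle
    have hlog : 1 ≤ Real.logb 2 (2 * Real.exp 1 * (k : ℝ)) := by
      rw [Real.le_logb_iff_rpow_le one_lt_two (by positivity), Real.rpow_one]
      nlinarith [Real.add_one_le_exp (1 : ℝ)]
    have : (d : ℝ) * 1 * 1 ≤
        d * (2 * (k : ℝ)) * Real.logb 2 (2 * Real.exp 1 * (k : ℝ)) := by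
      gcongr
      linarith
    linarith
  · have hn' : (0 : ℝ) < C.card := by exact_mod_cast hd0.trans_le hle
    have hpow : (2 : ℝ) ^ C.card ≤ ((Real.exp 1 * (C.card / d)) ^ d) ^ k := by
      calc (2 : ℝ) ^ C.card ≤ (∑ i ∈ Finset.range (d + 1), (C.card.choose i : ℝ)) ^ k := by
            exact_mod_cast hcount
        _ ≤ _ := by
            gcongr
            exact sum_range_choose_le_exp_mul_div_pow hd0 hle
    have hlog := Real.logb_le_logb_of_le one_lt_two (by positivity) hpow
    rw [Real.logb_pow, Real.logb_pow, Real.logb_pow, Real.logb_self_eq_one one_lt_two,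
      mul_one] at hlog
    have hx : (C.card / d : ℝ) ≤ k * Real.logb 2 (Real.exp 1 * (C.card / d)) := by
      rw [div_le_iff₀ hd']
      linarith
    have := le_of_le_mul_logb_exp_mul (by positivity) (by linarith) hx
    rw [div_le_iff₀ hd'] at this
    linarith
end

section
/- Let H ⊆ {0,1}^X and Φ ⊆ {0,1}^{X*} be hypothesis classes with VCdim(H) = d > 1 and VCdim(Φ) = d* > 1. Then the auxiliary loss class L^a_{(H,Φ)} satisfies VCdim(L^a_{(H,Φ)}) ≥ d + d* − 2. -/
/-- The auxiliary loss `ℓ^a_{(h,φ)}(x,x*,y) = 1[h(x) ≠ y ∧ φ(x*) = 0]`. -/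
def auxLoss {X Xs : Type*} (h : X → Bool) (φ : Xs → Bool) : X × Xs × Bool → Bool :=
  fun p => (h p.1 != p.2.2) && !(φ p.2.1)

/-- The auxiliary loss class `L^a_{(H,Φ)}`. -/
def LaClass {X Xs : Type*} (H : Set (X → Bool)) (Φ : Set (Xs → Bool)) :
    Set (X × Xs × Bool → Bool) :=
  { f | ∃ h ∈ H, ∃ φ ∈ Φ, f = auxLoss h φ }

theorem exists_shatters_of_le_vcDim {Z : Type*} {G : Set (Z → Bool)} {n : ℕ} (hn : 0 < n)
    (h : (n : ℕ∞) ≤ vcDim G) : ∃ C : Finset Z, Shatters G C ∧ n ≤ C.card := by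
  by_contra! hlt
  have hle : vcDim G ≤ ((n - 1 : ℕ) : ℕ∞) :=
    iSup₂_le fun C hC => Nat.cast_le.2 (Nat.le_sub_one_of_lt (hlt C hC))
  have : n ≤ n - 1 := Nat.cast_le.1 (h.trans hle)
  omega

open Classical in
/-- Deleting a point `a` from `A` and a point `b` from `B`, the two slices
`(A \ {a}) × {b}` and `{a} × (B \ {b})`, labelled by `false`, are jointly shattered. -/
theorem Shatters.laClass {X Xs : Type*} {H : Set (X → Bool)} {Φ : Set (Xs → Bool)}
    {A : Finset X} {B : Finset Xs} (hA : Shatters H A) (hB : Shatters Φ B)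
    {a : X} {b : Xs} (ha : a ∈ A) (hb : b ∈ B) :
    Shatters (LaClass H Φ)
      ((A.erase a).image (fun x => (x, b, false)) ∪
        (B.erase b).image (fun t => (a, t, false))) := by
  intro f
  obtain ⟨h, hH, hh⟩ := hA fun x => if x = a then true else f (x, b, false)
  obtain ⟨φ, hΦ, hφ⟩ := hB fun t => if t = b then false else !f (a, t, false)
  refine ⟨auxLoss h φ, ⟨h, hH, φ, hΦ, rfl⟩, fun z hz => ?_⟩
  simp only [Finset.mem_union, Finset.mem_image, Finset.mem_erase] at hz
  rcases hz with ⟨x, ⟨hxa, hx⟩, rfl⟩ | ⟨t, ⟨htb, ht⟩, rfl⟩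
  · simp [auxLoss, hh x hx, hφ b hb, hxa]
  · simp [auxLoss, hh a ha, hφ t ht, htb]

open Classical in
theorem card_erase_image_union_erase_image {X Xs : Type*} {A : Finset X} {B : Finset Xs}
    {a : X} {b : Xs} (ha : a ∈ A) (hb : b ∈ B) :
    ((A.erase a).image (fun x => (x, b, false)) ∪
      (B.erase b).image (fun t => (a, t, false))).card = (A.card - 1) + (B.card - 1) := by
  rw [Finset.card_union_of_disjoint, Finset.card_image_of_injective,
    Finset.card_image_of_injective, Finset.card_erase_of_mem ha, Finset.card_erase_of_mem hb]
  · intro t t' h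
    simpa using h
  · intro x x' h
    simpa using h
  · rw [Finset.disjoint_left]
    intro z hz hz'
    simp only [Finset.mem_image, Finset.mem_erase] at hz hz'
    obtain ⟨x, ⟨hxa, -⟩, rfl⟩ := hz
    obtain ⟨t, -, ht⟩ := hz'
    exact hxa (congrArg Prod.fst ht).symm

/-- If `VCdim(H) = d > 1` and `VCdim(Φ) = d* > 1`, then the auxiliary loss class
satisfies `VCdim(L^a_{(H,Φ)}) ≥ d + d* − 2`. -/
theorem aux_loss_class_vc_lower_bound
    {X Xs : Type*} (H : Set (X → Bool)) (Φ : Set (Xs → Bool)) (d dstar : ℕ)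
    (hH : vcDim H = (d : ℕ∞)) (hΦ : vcDim Φ = (dstar : ℕ∞))
    (hd : 1 < d) (hds : 1 < dstar) :
    ((d + dstar - 2 : ℕ) : ℕ∞) ≤ vcDim (LaClass H Φ) := by
  obtain ⟨A, hA, hdA⟩ := exists_shatters_of_le_vcDim (by omega) hH.ge
  obtain ⟨B, hB, hdB⟩ := exists_shatters_of_le_vcDim (by omega) hΦ.ge
  obtain ⟨a, ha⟩ : A.Nonempty := Finset.card_pos.1 (by omega)
  obtain ⟨b, hb⟩ : B.Nonempty := Finset.card_pos.1 (by omega)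
  refine le_trans (Nat.cast_le.2 ?_) (hA.laClass hB ha hb).card_le_vcDim
  rw [card_erase_image_union_erase_image ha hb]
  omega
end

section
/- Fix m ∈ ℕ, δ ∈ (0,1), and real numbers d, d*, d_a > 0. Define R_f(d') := (8·d'·log(m+1) + 4·log(4/δ))/m and R_s(x, d') := √(x·R_f(d')). Let ε̂_ERM, ε̂_ig, ε̂_u ∈ [0,1] with ε̂_ERM = ε̂_ig + ε̂_u, and define B_PR := ε̂_ig + ε̂_u + R_s(ε̂_ig, d*) + R_s(ε̂_u, d_a) + R_f(d*) + R_f(d_a) and B_ERM := ε̂_ERM + R_s(ε̂_ERM, d) + R_f(d). If √(ε̂_u)·R_s(1, d_a) ≤ √(ε̂_ERM)·(R_s(1, d) − R_s(1, d*)) + R_f(d) − R_f(d*) − R_f(d_a), then B_PR ≤ B_ERM. -/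
/-- The fast-rate term `R_f(d') = (8 d' log(m+1) + 4 log(4/δ)) / m`. -/
noncomputable def Rf (m : ℕ) (δ d' : ℝ) : ℝ :=
  (8 * d' * Real.log ((m : ℝ) + 1) + 4 * Real.log (4 / δ)) / (m : ℝ)

/-- The slow-rate term `R_s(x, d') = √(x · R_f(d'))`. -/
noncomputable def Rs (m : ℕ) (δ x d' : ℝ) : ℝ :=
  Real.sqrt (x * Rf m δ d')

/-- Sufficient condition for the Privileged ERM bound to improve over the ERM bound:
if `ε̂_ERM = ε̂_ig + ε̂_u` and
`√ε̂_u · R_s(1, d_a) ≤ √ε̂_ERM · (R_s(1,d) − R_s(1,d*)) + R_f(d) − R_f(d*) − R_f(d_a)`,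
then `B_PR ≤ B_ERM`. -/
theorem privileged_bound_le_erm_bound_of_sufficient
    (m : ℕ) (δ d dstar da εerm εig εu : ℝ)
    (hδ : δ ∈ Set.Ioo (0 : ℝ) 1) (hd : 0 < d) (hds : 0 < dstar) (hda : 0 < da)
    (herm : εerm ∈ Set.Icc (0 : ℝ) 1) (hig : εig ∈ Set.Icc (0 : ℝ) 1)
    (hu : εu ∈ Set.Icc (0 : ℝ) 1)
    (heq : εerm = εig + εu)
    (hcond : Real.sqrt εu * Rs m δ 1 da ≤
      Real.sqrt εerm * (Rs m δ 1 d - Rs m δ 1 dstar)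
        + Rf m δ d - Rf m δ dstar - Rf m δ da) :
    εig + εu + Rs m δ εig dstar + Rs m δ εu da + Rf m δ dstar + Rf m δ da
      ≤ εerm + Rs m δ εerm d + Rf m δ d := by
  have hRs : ∀ {x : ℝ} (d' : ℝ), 0 ≤ x → Rs m δ x d' = √x * Rs m δ 1 d' := by
    intro x d' hx
    simp only [Rs, one_mul, Real.sqrt_mul hx]
  have hmono : √εig * Rs m δ 1 dstar ≤ √εerm * Rs m δ 1 dstar :=
    mul_le_mul_of_nonneg_right (Real.sqrt_le_sqrt (by linarith [hu.1])) (Real.sqrt_nonneg _)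
  rw [hRs dstar hig.1, hRs da hu.1, hRs d herm.1]
  linarith
end

section
/- Fix m ∈ ℕ with m ≥ 1, δ ∈ (0,1), and real numbers d, d*, d_a > 0 satisfying d − d* − d_a < 0. Define R_f(d') := (8·d'·log(m+1) + 4·log(4/δ))/m, R_s(x, d') := √(x·R_f(d')), and A := log(4/δ)/(2·log(m+1)). Let ε̂_ERM, ε̂_ig, ε̂_u ∈ [0,1] with ε̂_ERM ≤ ε̂_ig + ε̂_u, and define B_PR := ε̂_ig + ε̂_u + R_s(ε̂_ig, d*) + R_s(ε̂_u, d_a) + R_f(d*) + R_f(d_a) and B_ERM := ε̂_ERM + R_s(ε̂_ERM, d) + R_f(d). If B_PR ≤ B_ERM, then √(ε̂_u) ≤ ( √(ε̂_ERM·(d + A)) − √(ε̂_ig·(d* + A)) ) / √(d_a + A). -/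
theorem Rf_eq_mul_add {m : ℕ} (hm : 1 ≤ m) (δ d : ℝ) :
    Rf m δ d = 8 * Real.log ((m : ℝ) + 1) / m *
      (d + Real.log (4 / δ) / (2 * Real.log ((m : ℝ) + 1))) := by
  have hm' : (0 : ℝ) < m := by exact_mod_cast hm
  have hL : 0 < Real.log ((m : ℝ) + 1) := Real.log_pos (by linarith)
  unfold Rf
  field_simp
  ring

theorem Rs_eq_sqrt_mul_sqrt {m : ℕ} (hm : 1 ≤ m) (δ x d : ℝ) :
    Rs m δ x d = √(8 * Real.log ((m : ℝ) + 1) / m) *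
      √(x * (d + Real.log (4 / δ) / (2 * Real.log ((m : ℝ) + 1)))) := by
  have hL : 0 ≤ Real.log ((m : ℝ) + 1) := Real.log_nonneg (by simp)
  rw [Rs, Rf_eq_mul_add hm, ← Real.sqrt_mul (by positivity)]
  congr 1
  ring

/-- Necessary condition for the Privileged ERM bound to improve over the ERM bound:
if `d − d* − d_a < 0`, `ε̂_ERM ≤ ε̂_ig + ε̂_u`, and `B_PR ≤ B_ERM`, then
`√ε̂_u ≤ (√(ε̂_ERM (d + A)) − √(ε̂_ig (d* + A))) / √(d_a + A)`,
where `A = log(4/δ) / (2 log(m+1))`. -/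
theorem necessary_condition_of_privileged_bound_le
    (m : ℕ) (hm : 1 ≤ m) (δ d dstar da εerm εig εu : ℝ)
    (hδ : δ ∈ Set.Ioo (0 : ℝ) 1) (hd : 0 < d) (hds : 0 < dstar) (hda : 0 < da)
    (hdd : d - dstar - da < 0)
    (herm : εerm ∈ Set.Icc (0 : ℝ) 1) (hig : εig ∈ Set.Icc (0 : ℝ) 1)
    (hu : εu ∈ Set.Icc (0 : ℝ) 1)
    (hle : εerm ≤ εig + εu)
    (hB : εig + εu + Rs m δ εig dstar + Rs m δ εu da + Rf m δ dstar + Rf m δ da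
      ≤ εerm + Rs m δ εerm d + Rf m δ d) :
    Real.sqrt εu ≤
      (Real.sqrt (εerm * (d + Real.log (4 / δ) / (2 * Real.log ((m : ℝ) + 1))))
        - Real.sqrt (εig * (dstar + Real.log (4 / δ) / (2 * Real.log ((m : ℝ) + 1)))))
      / Real.sqrt (da + Real.log (4 / δ) / (2 * Real.log ((m : ℝ) + 1))) := by
  have hm' : (0 : ℝ) < m := by exact_mod_cast hm
  have hL : 0 < Real.log ((m : ℝ) + 1) := Real.log_pos (by linarith)
  have hlog : 0 < Real.log (4 / δ) :=
    Real.log_pos ((one_lt_div hδ.1).2 (by linarith [hδ.2]))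
  simp only [Rs_eq_sqrt_mul_sqrt hm, Rf_eq_mul_add hm] at hB
  set A := Real.log (4 / δ) / (2 * Real.log ((m : ℝ) + 1))
  set C := 8 * Real.log ((m : ℝ) + 1) / m
  have hA : 0 < A := by positivity
  have hC : 0 < C := by positivity
  have hfast : 0 ≤ C * (dstar + da + A - d) := mul_nonneg hC.le (by linarith)
  have hslow : √(εig * (dstar + A)) + √(εu * (da + A)) ≤ √(εerm * (d + A)) :=
    le_of_mul_le_mul_left (by linarith) (Real.sqrt_pos.2 hC)
  rw [le_div_iff₀ (Real.sqrt_pos.2 (by linarith)), ← Real.sqrt_mul hu.1]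
  linarith
end
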